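/- Let (F, D) be a duality pair of Δ-structures such that D is a core, and let n be the number of vertices of F. Then D has at most n^n vertices. -/

import Mathlib

/-! Framework: finite relational structures of a fixed type Δ = (δ i : i ∈ I),
homomorphisms, cores, sums, products, exponentials, shadows, trees, forests,
duality pairs, finite dualities, transversals, antichains. -/

namespace ThesisFormal

/-- A finite relational structure of type `Δ = (δ i : i ∈ I)`:
a finite nonempty base set together with a `δ i`-ary relation for each `i ∈ I`. -/
structure RelStruct (I : Type) (δ : I → ℕ) : Type 1 where
  carrier : Type
  finite : Finite carrier
  nonempty : Nonempty carrier
  rel : ∀ i : I, Set ((Fin (δ i)) → carrier)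

namespace RelStruct

variable {I : Type} {δ : I → ℕ}

/-- `f` is a homomorphism from `A` to `B`. -/
def IsHom (A B : RelStruct I δ) (f : A.carrier → B.carrier) : Prop :=
  ∀ i : I, ∀ e ∈ A.rel i, (f ∘ e) ∈ B.rel i

/-- `A → B`: some homomorphism from `A` to `B` exists. -/
def HomTo (A B : RelStruct I δ) : Prop := ∃ f, IsHom A B f

/-- `A ≈ B`: homomorphic equivalence. -/
def HomEquiv (A B : RelStruct I δ) : Prop := HomTo A B ∧ HomTo B A

/-- `A` and `B` are incomparable: no homomorphism either way. -/
def Incomparable (A B : RelStruct I δ) : Prop := ¬ HomTo A B ∧ ¬ HomTo B A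

/-- `A ≅ B`: a bijective homomorphism whose inverse is also a homomorphism. -/
def Isomorphic (A B : RelStruct I δ) : Prop :=
  ∃ f : A.carrier ≃ B.carrier, IsHom A B f ∧ IsHom B A f.symm

/-- A retraction of `A`: an endomorphism fixing its image pointwise. -/
def IsRetraction (A : RelStruct I δ) (f : A.carrier → A.carrier) : Prop :=
  IsHom A A f ∧ ∀ x ∈ Set.range f, f x = x

/-- A core: a structure with no proper retracts (every retraction is surjective). -/
def IsCore (A : RelStruct I δ) : Prop :=
  ∀ f, IsRetraction A f → Function.Surjective f

/-- The substructure of `A` induced by a nonempty `S ⊆ |A|`. -/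
noncomputable def Substruct (A : RelStruct I δ) (S : Set A.carrier) (hS : S.Nonempty) :
    RelStruct I δ where
  carrier := S
  finite := by haveI := A.finite; exact Subtype.finite
  nonempty := hS.to_subtype
  rel i := {e | (fun j => (e j : A.carrier)) ∈ A.rel i}

/-- `C` is a retract of `A`: the substructure induced by the image of a retraction. -/
def IsRetractOf (C A : RelStruct I δ) : Prop :=
  ∃ f, IsRetraction A f ∧
    C = A.Substruct (Set.range f) ⟨f A.nonempty.some, Set.mem_range_self _⟩

/-- The sum (disjoint union) `A + B`. -/
noncomputable def sum (A B : RelStruct I δ) : RelStruct I δ where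
  carrier := A.carrier ⊕ B.carrier
  finite := by haveI := A.finite; haveI := B.finite; infer_instance
  nonempty := ⟨Sum.inl A.nonempty.some⟩
  rel i := {e | (∃ ea ∈ A.rel i, e = Sum.inl ∘ ea) ∨ (∃ eb ∈ B.rel i, e = Sum.inr ∘ eb)}

/-- The product `A × B`. -/
noncomputable def prod (A B : RelStruct I δ) : RelStruct I δ where
  carrier := A.carrier × B.carrier
  finite := by haveI := A.finite; haveI := B.finite; infer_instance
  nonempty := ⟨(A.nonempty.some, B.nonempty.some)⟩
  rel i := {e | (fun j => (e j).1) ∈ A.rel i ∧ (fun j => (e j).2) ∈ B.rel i}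

/-- The exponential structure `C ^ B`. -/
noncomputable def exp (C B : RelStruct I δ) : RelStruct I δ where
  carrier := B.carrier → C.carrier
  finite := by haveI := B.finite; haveI := C.finite; infer_instance
  nonempty := ⟨fun _ => C.nonempty.some⟩
  rel i := {f | ∀ e ∈ B.rel i, (fun j => f j (e j)) ∈ C.rel i}

/-- The sum of a finite nonempty family of structures. -/
noncomputable def sigmaSum {J : Type} (hJfin : Finite J) (hJne : Nonempty J)
    (A : J → RelStruct I δ) : RelStruct I δ where
  carrier := Σ j, (A j).carrier
  finite := by
    haveI := hJfin
    haveI : ∀ j, Finite ((A j).carrier) := fun j => (A j).finite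
    infer_instance
  nonempty := ⟨⟨hJne.some, (A hJne.some).nonempty.some⟩⟩
  rel i := {e | ∃ j, ∃ ea ∈ (A j).rel i, e = fun k => ⟨j, ea k⟩}

/-- The product of a finite family of structures. -/
noncomputable def piProd {J : Type} (hJfin : Finite J)
    (A : J → RelStruct I δ) : RelStruct I δ where
  carrier := ∀ j, (A j).carrier
  finite := by
    haveI := hJfin
    haveI : ∀ j, Finite ((A j).carrier) := fun j => (A j).finite
    infer_instance
  nonempty := ⟨fun j => (A j).nonempty.some⟩
  rel i := {e | ∀ j, (fun k => e k j) ∈ (A j).rel i}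

/-- An edge of the shadow multigraph `Sh(A)`: one edge joining `e j` and `e (j+1)`
for each edge `e ∈ R i (A)` and each `j` with `j + 1 < δ i`. -/
structure ShadowEdge (A : RelStruct I δ) : Type where
  i : I
  e : Fin (δ i) → A.carrier
  mem : e ∈ A.rel i
  j : ℕ
  hj : j + 1 < δ i

/-- First endpoint of a shadow edge. -/
def ShadowEdge.src {A : RelStruct I δ} (s : ShadowEdge A) : A.carrier :=
  s.e ⟨s.j, Nat.lt_of_succ_lt s.hj⟩

/-- Second endpoint of a shadow edge. -/
def ShadowEdge.tgt {A : RelStruct I δ} (s : ShadowEdge A) : A.carrier :=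
  s.e ⟨s.j + 1, s.hj⟩

/-- The adjacency relation of the shadow `Sh(A)`. -/
def shadowAdj (A : RelStruct I δ) (a b : A.carrier) : Prop :=
  ∃ s : ShadowEdge A, (s.src = a ∧ s.tgt = b) ∨ (s.src = b ∧ s.tgt = a)

/-- The shadow of `A` is connected. -/
def ShadowConnected (A : RelStruct I δ) : Prop :=
  ∀ a b : A.carrier, Relation.ReflTransGen (shadowAdj A) a b

/-- `A` is a Δ-tree: its shadow multigraph is a tree, i.e. it is connected and
the number of edge occurrences is one less than the number of vertices
(this rules out cycles, loops and parallel edges). -/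
def IsTreeStruct (A : RelStruct I δ) : Prop :=
  ShadowConnected A ∧ Nat.card (ShadowEdge A) + 1 = Nat.card A.carrier

/-- The number of connected components of the shadow of `A`. -/
noncomputable def numComponents (A : RelStruct I δ) : ℕ :=
  Nat.card (Quot (shadowAdj A))

/-- `A` is a Δ-forest: every component of its shadow multigraph is a tree. -/
def IsForestStruct (A : RelStruct I δ) : Prop :=
  Nat.card (ShadowEdge A) + numComponents A = Nat.card A.carrier

/-- The component of `A` containing the vertex `a`. -/
noncomputable def componentOf (A : RelStruct I δ) (a : A.carrier) : RelStruct I δ :=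
  A.Substruct {b | Relation.ReflTransGen (shadowAdj A) a b}
    ⟨a, Relation.ReflTransGen.refl⟩

/-- `(F, D)` is a duality pair: for every `A`, `F → A` iff `A ↛ D`. -/
def DualityPair (F D : RelStruct I δ) : Prop :=
  ∀ A : RelStruct I δ, HomTo F A ↔ ¬ HomTo A D

/-- `(F, D)` is a finite homomorphism duality: `F` and `D` are finite sets of
pairwise incomparable cores and for every `X`, some member of `F` maps to `X`
iff `X` maps to no member of `D`. -/
def FiniteDuality (F D : Set (RelStruct I δ)) : Prop :=
  F.Finite ∧ D.Finite ∧
  (∀ A ∈ F, IsCore A) ∧ (∀ A ∈ D, IsCore A) ∧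
  F.Pairwise Incomparable ∧ D.Pairwise Incomparable ∧
  ∀ X : RelStruct I δ, (∃ A ∈ F, HomTo A X) ↔ (∀ B ∈ D, ¬ HomTo X B)

/-- The set of connected components of `A`. -/
def componentsSet (A : RelStruct I δ) : Set (RelStruct I δ) :=
  {C | ∃ a : A.carrier, C = componentOf A a}

/-- The set `ℱ_c` of connected components of the members of `F`. -/
def componentsOfFamily (F : Set (RelStruct I δ)) : Set (RelStruct I δ) :=
  ⋃ A ∈ F, componentsSet A

/-- A quasitransversal over `F`: a set of pairwise incomparable components of
members of `F` supporting `F`. -/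
def Quasitransversal (F M : Set (RelStruct I δ)) : Prop :=
  M ⊆ componentsOfFamily F ∧ M.Pairwise Incomparable ∧
  ∀ A ∈ F, ∃ C ∈ M, HomTo C A

/-- The order on quasitransversals: `M ⪯ M'` iff every member of `M'` admits a
homomorphism from some member of `M`. -/
def QTle (M M' : Set (RelStruct I δ)) : Prop :=
  ∀ C' ∈ M', ∃ C ∈ M, HomTo C C'

/-- A transversal: a `⪯`-maximal quasitransversal. -/
def IsTransversal (F M : Set (RelStruct I δ)) : Prop :=
  Quasitransversal F M ∧ ∀ M', Quasitransversal F M' → QTle M M' → M' = M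

/-- The product of a family of structures indexed by `Fin n`. -/
noncomputable def finProd (n : ℕ) (A : Fin n → RelStruct I δ) : RelStruct I δ :=
  piProd (inferInstance : Finite (Fin n)) A

/-- `D` is (isomorphic to) `D(M)`, the core of the product of the duals `D(C)`
of the members `C` of the finite set `M`. -/
def IsSetDual (M : Set (RelStruct I δ)) (D : RelStruct I δ) : Prop :=
  IsCore D ∧ ∃ (n : ℕ) (C DC : Fin n → RelStruct I δ),
    Function.Injective C ∧ Set.range C = M ∧
    (∀ k, IsCore (DC k) ∧ DualityPair (C k) (DC k)) ∧
    HomEquiv D (finProd n DC)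

/-- `D` is the result (up to isomorphism) of the transversal construction on `F`:
its members are exactly the duals of the transversals over `F`, one for each
transversal. -/
def TransversalDualSet (F D : Set (RelStruct I δ)) : Prop :=
  (∀ d ∈ D, ∃ M, IsTransversal F M ∧ IsSetDual M d) ∧
  (∀ M, IsTransversal F M → ∃ d ∈ D, IsSetDual M d) ∧
  (∀ d ∈ D, ∀ d' ∈ D, ∀ M : Set (RelStruct I δ),
    IsSetDual M d → IsSetDual M d' → d = d')

/-- `Q` is a maximal antichain in the homomorphism order: a set of pairwise
incomparable cores such that every structure is comparable with some member. -/
def IsMaxAntichain (Q : Set (RelStruct I δ)) : Prop :=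
  (∀ A ∈ Q, IsCore A) ∧ Q.Pairwise Incomparable ∧
  ∀ X : RelStruct I δ, ∃ A ∈ Q, HomTo X A ∨ HomTo A X

/-- The maximal antichain `Q` splits. -/
def Splits (Q : Set (RelStruct I δ)) : Prop :=
  ∃ Q₁ Q₂ : Set (RelStruct I δ), Q₁ ∪ Q₂ = Q ∧ Disjoint Q₁ Q₂ ∧
    ∀ X : RelStruct I δ, (∃ A ∈ Q₁, HomTo A X) ∨ (∃ B ∈ Q₂, HomTo X B)

/-- `A < B` in the homomorphism order. -/
def StrictHom (A B : RelStruct I δ) : Prop := HomTo A B ∧ ¬ HomTo B A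

/-- (The homomorphic-equivalence class of) `Y` is a cutting point in the
homomorphism order. -/
def CuttingPoint (Y : RelStruct I δ) : Prop :=
  ∃ X Z : RelStruct I δ, StrictHom X Y ∧ StrictHom Y Z ∧
    ∀ W : RelStruct I δ, HomTo X W → HomTo W Z → (HomTo W Y ∨ HomTo Y W)

/-- `A` has at most one edge of each kind. -/
def AtMostOneEdgePerKind (A : RelStruct I δ) : Prop :=
  ∀ i : I, ∀ e ∈ A.rel i, ∀ e' ∈ A.rel i, e = e'

end RelStruct

end ThesisFormal

namespace ThesisFormal

namespace RelStruct

variable {I : Type} {δ : I → ℕ}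

attribute [local instance] RelStruct.finite RelStruct.nonempty

lemma IsHom.comp {A B C : RelStruct I δ} {g : B.carrier → C.carrier} {f : A.carrier → B.carrier}
    (hg : IsHom B C g) (hf : IsHom A B f) : IsHom A C (g ∘ f) :=
  fun i e he => hg i _ (hf i e he)

lemma IsHom.iterate {A : RelStruct I δ} {f : A.carrier → A.carrier} (hf : IsHom A A f) (k : ℕ) :
    IsHom A A f^[k] := by
  induction k with
  | zero => exact fun i e he => he
  | succ k ih => exact ih.comp hf

lemma HomTo.refl (A : RelStruct I δ) : HomTo A A := ⟨id, fun _ _ he => he⟩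

lemma HomTo.trans {A B C : RelStruct I δ} (hAB : HomTo A B) (hBC : HomTo B C) : HomTo A C := by
  obtain ⟨f, hf⟩ := hAB
  obtain ⟨g, hg⟩ := hBC
  exact ⟨g ∘ f, hg.comp hf⟩

lemma DualityPair.not_homTo {F D : RelStruct I δ} (h : DualityPair F D) : ¬ HomTo F D :=
  (h F).1 (HomTo.refl F)

lemma DualityPair.of_homEquiv {F F' D : RelStruct I δ} (h : DualityPair F D)
    (hF : HomEquiv F F') : DualityPair F' D := fun A =>
  ⟨fun hA => (h A).1 (hF.1.trans hA), fun hA => hF.2.trans ((h A).2 hA)⟩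

/-- Every endomorphism of a core is injective. -/
lemma IsCore.injective {A : RelStruct I δ} (hA : A.IsCore) {f : A.carrier → A.carrier}
    (hf : IsHom A A f) : Function.Injective f := by
  obtain ⟨a, b, hab, heq⟩ : ∃ a b : ℕ, a < b ∧ f^[a] = f^[b] := by
    obtain ⟨a, b, hne, heq⟩ := Finite.exists_ne_map_eq_of_infinite (fun k : ℕ => f^[k])
    rcases lt_or_gt_of_ne hne with h | h
    · exact ⟨a, b, h, heq⟩
    · exact ⟨b, a, h, heq.symm⟩
  obtain ⟨p, hp, rfl⟩ : ∃ p, 0 < p ∧ b = a + p := ⟨b - a, by omega, by omega⟩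
  have period : ∀ m, a ≤ m → ∀ q, f^[m + q * p] = f^[m] := by
    intro m hm q
    induction q with
    | zero => simp
    | succ q ih =>
      obtain ⟨c, rfl⟩ := Nat.exists_eq_add_of_le hm
      have e1 : a + c + (q + 1) * p = (c + q * p) + (a + p) := by ring
      have e2 : a + c + q * p = (c + q * p) + a := by ring
      rw [← ih, e1, e2, Function.iterate_add, Function.iterate_add f _ a, heq]
  set k := (a + 1) * p with hk
  have hak : a ≤ k := by nlinarith
  have hidem : f^[k + k] = f^[k] := period k hak (a + 1)
  have hsurj : Function.Surjective f^[k] := by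
    apply hA
    refine ⟨hf.iterate k, ?_⟩
    rintro _ ⟨x, rfl⟩
    rw [← Function.iterate_add_apply, hidem]
  have hk0 : k = (k - 1) + 1 := by
    have : 0 < k := by positivity
    omega
  rw [hk0, Function.iterate_succ'] at hsurj
  exact Finite.injective_iff_surjective.2 hsurj.of_comp

/-- A duality pair can be shrunk to one whose left-hand side has only surjective
endomorphisms. -/
lemma DualityPair.exists_rigid {F D : RelStruct I δ} (h : DualityPair F D) :
    ∃ F' : RelStruct I δ, DualityPair F' D ∧ Nat.card F'.carrier ≤ Nat.card F.carrier ∧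
      ∀ f, IsHom F' F' f → Function.Surjective f := by
  induction hn : Nat.card F.carrier using Nat.strong_induction_on generalizing F with
  | _ n ih =>
    by_cases hF : ∀ f, IsHom F F f → Function.Surjective f
    · exact ⟨F, h, hn.le, hF⟩
    push Not at hF
    obtain ⟨f, hf, hns⟩ := hF
    let S := F.Substruct (Set.range f) (Set.range_nonempty f)
    have hFS : HomEquiv F S :=
      ⟨⟨fun x => ⟨f x, x, rfl⟩, fun i e he => hf i e he⟩, ⟨fun x => x.1, fun i e he => he⟩⟩
    have hlt : Nat.card S.carrier < n := by
      rw [← hn]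
      change Nat.card (Set.range f) < _
      apply lt_of_le_of_ne (Finite.card_subtype_le _)
      intro heq
      apply hns
      have := (Set.eq_univ_iff_ncard (Set.range f)).2 heq
      exact Set.range_eq_univ.1 this
    obtain ⟨F', h1, h2, h3⟩ := ih _ hlt (h.of_homEquiv hFS) rfl
    exact ⟨F', h1, h2.trans hlt.le, h3⟩

/-- An indexed tuple of vertices, a potential edge. -/
abbrev Tuple (A : RelStruct I δ) : Type := Σ i : I, Fin (δ i) → A.carrier

/-- `e` is an edge of `A`. -/
def IsEdge (A : RelStruct I δ) (e : A.Tuple) : Prop := e.2 ∈ A.rel e.1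

/-- `a` and `b` lie on a common edge other than `e`. -/
def AdjAvoiding (A : RelStruct I δ) (e : A.Tuple) (a b : A.carrier) : Prop :=
  ∃ e' : A.Tuple, e' ≠ e ∧ A.IsEdge e' ∧ a ∈ Set.range e'.2 ∧ b ∈ Set.range e'.2

/-- `a` and `b` are connected in `A` with the edge `e` deleted. -/
def ConnAvoiding (A : RelStruct I δ) (e : A.Tuple) : A.carrier → A.carrier → Prop :=
  Relation.ReflTransGen (A.AdjAvoiding e)

lemma ConnAvoiding.symm {A : RelStruct I δ} {e : A.Tuple} {a b : A.carrier}
    (h : A.ConnAvoiding e a b) : A.ConnAvoiding e b a :=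
  haveI : Std.Symm (A.AdjAvoiding e) :=
    ⟨fun _ _ ⟨e', h1, h2, h3, h4⟩ => ⟨e', h1, h2, h4, h3⟩⟩
  Relation.ReflTransGen.stdSymm.symm _ _ h

lemma ConnAvoiding.trans {A : RelStruct I δ} {e : A.Tuple} {a b c : A.carrier}
    (h : A.ConnAvoiding e a b) (h' : A.ConnAvoiding e b c) : A.ConnAvoiding e a c :=
  Relation.ReflTransGen.trans h h'

lemma IsEdge.connAvoiding {A : RelStruct I δ} {e e' : A.Tuple} (he' : A.IsEdge e') (hne : e' ≠ e)
    (j k : Fin (δ e'.1)) : A.ConnAvoiding e (e'.2 j) (e'.2 k) :=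
  Relation.ReflTransGen.single ⟨e', hne, he', ⟨j, rfl⟩, ⟨k, rfl⟩⟩

/-- Deleting any edge of `A` separates all of its positions. -/
def Acyclic (A : RelStruct I δ) : Prop :=
  ∀ e, A.IsEdge e → ∀ k l, k ≠ l → ¬ A.ConnAvoiding e (e.2 k) (e.2 l)

section Unfolding

variable (F : RelStruct I δ) (v : F.carrier) (X : Type)

open Classical in
/-- The copy of `F` with index `p` inside the unfolding at `v`; the vertex `v` is shared by all
copies with the same first index. -/
noncomputable def unfoldCopy (p : X × X) (u : F.carrier) : F.carrier × X × X ⊕ X :=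
  if u = v then Sum.inr p.1 else Sum.inl (u, p)

/-- For each pair `x ≠ y` take a copy of `F` in which `v` becomes `x`, except
in position `k` of the edge `e`, where it becomes `y`. -/
noncomputable def unfolding [Finite X] [Nonempty X] (e : F.Tuple) (k : Fin (δ e.1)) :
    RelStruct I δ where
  carrier := F.carrier × X × X ⊕ X
  finite := inferInstance
  nonempty := inferInstance
  rel i := {s | ∃ p : X × X, p.1 ≠ p.2 ∧
    ((∃ t, t ∈ F.rel i ∧ (⟨i, t⟩ : F.Tuple) ≠ e ∧ s = unfoldCopy F v X p ∘ t) ∨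
      (⟨i, s⟩ : Σ i : I, Fin (δ i) → F.carrier × X × X ⊕ X) =
        ⟨e.1, Function.update (unfoldCopy F v X p ∘ e.2) k (Sum.inr p.2)⟩)}

end Unfolding

/-- If all endomorphisms of `F` are surjective and `F` is the left-hand side of a duality pair
then `F` is acyclic. -/
lemma DualityPair.acyclic {F D : RelStruct I δ} (h : DualityPair F D)
    (hF : ∀ f, IsHom F F f → Function.Surjective f) : F.Acyclic := by
  classical
  intro e he k l hkl hconn
  set v := e.2 k with hv
  let X := Option D.carrier
  let G := unfolding F v X e k
  have hG : ¬ HomTo G D := by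
    rintro ⟨g, hg⟩
    have hnotinj : ¬ Function.Injective (fun x : X => g (Sum.inr x)) := by
      intro hinj
      have := Nat.card_le_card_of_injective _ hinj
      rw [Finite.card_option] at this
      omega
    rw [Function.not_injective_iff] at hnotinj
    obtain ⟨x, y, hxy, hne⟩ := hnotinj
    apply h.not_homTo
    refine ⟨fun u => g (unfoldCopy F v X (x, y) u), fun i t ht => ?_⟩
    by_cases hte : (⟨i, t⟩ : F.Tuple) = e
    · subst hte
      have := hg i _ ⟨(x, y), hne, Or.inr rfl⟩
      convert this using 1
      funext j
      by_cases hj : j = k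
      · subst hj
        simpa only [hv, unfoldCopy, Function.comp, Function.update_self, if_true] using hxy
      · simp only [Function.comp, Function.update_of_ne hj]
    · exact hg i _ ⟨(x, y), hne, Or.inl ⟨t, ht, hte, rfl⟩⟩
  obtain ⟨s₀, hs₀⟩ := (h G).2 hG
  let π : G.carrier → F.carrier := Sum.elim Prod.fst (fun _ => v)
  have hπc : ∀ p u, π (unfoldCopy F v X p u) = u := by
    intro p u
    by_cases hu : u = v <;> simp [π, unfoldCopy, hu]
  have hπ : IsHom G F π := by
    rintro i s ⟨p, -, ⟨t, ht, -, rfl⟩ | hs⟩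
    · convert ht using 1
      funext j
      exact hπc _ _
    · obtain ⟨i', t⟩ := e
      obtain rfl : i = i' := congrArg Sigma.fst hs
      obtain rfl := eq_of_heq (Sigma.mk.inj hs).2
      suffices π ∘ Function.update (unfoldCopy F v X p ∘ t) k (Sum.inr p.2) = t from
        this.symm ▸ he
      funext j
      by_cases hj : j = k
      · subst hj
        change π (Function.update (unfoldCopy F v X p ∘ t) j (Sum.inr p.2) j) = t j
        rw [Function.update_self]
        rfl
      · change π (Function.update (unfoldCopy F v X p ∘ t) k (Sum.inr p.2) j) = t j
        rw [Function.update_of_ne hj]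
        exact hπc _ _
  obtain ⟨s, hs, hsec⟩ : ∃ s, IsHom F G s ∧ ∀ u, π (s u) = u := by
    have hα := hπ.comp hs₀
    have hbij : Function.Bijective (π ∘ s₀) := Finite.surjective_iff_bijective.1 (hF _ hα)
    let α : Equiv.Perm F.carrier := Equiv.ofBijective _ hbij
    obtain ⟨m, hm, hpow⟩ := (isOfFinOrder_of_finite α).exists_pow_eq_one
    refine ⟨s₀ ∘ (π ∘ s₀)^[m - 1], hs₀.comp (hα.iterate _), fun u => ?_⟩
    have h1 : (α ^ m) u = u := by rw [hpow]; rfl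
    rw [← Equiv.Perm.iterate_eq_pow, ← Nat.sub_add_cancel hm, Function.iterate_succ'] at h1
    exact h1
  have hedge : ∀ e' : F.Tuple, F.IsEdge e' → e' ≠ e →
      ∃ q : X × X, ∀ j, s (e'.2 j) = unfoldCopy F v X q (e'.2 j) := by
    rintro ⟨i, t'⟩ he' hne
    obtain ⟨q, -, ⟨t, ht, -, hst⟩ | hst⟩ := hs i t' he'
    · refine ⟨q, fun j => ?_⟩
      have h1 : s (t' j) = unfoldCopy F v X q (t j) := congrFun hst j
      have h2 : t' j = t j := by rw [← hsec (t' j), h1, hπc]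
      change s (t' j) = unfoldCopy F v X q (t' j)
      rw [h1, h2]
    · exfalso
      apply hne
      obtain ⟨i', t⟩ := e
      obtain rfl : i = i' := congrArg Sigma.fst hst
      have hst := eq_of_heq (Sigma.mk.inj hst).2
      congr 1
      funext j
      have h1 := congrFun hst j
      rw [← hsec (t' j)]
      change π ((s ∘ t') j) = _
      rw [h1]
      by_cases hj : j = k
      · subst hj
        simp [π, hv]
      · rw [Function.update_of_ne hj]
        exact hπc _ _
  obtain ⟨p, hp, ⟨t, ht, hte, hst⟩ | hst⟩ := hs e.1 e.2 he
  · apply hte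
    obtain ⟨i, t'⟩ := e
    congr 1
    funext j
    have h1 : s (t' j) = unfoldCopy F v X p (t j) := congrFun hst j
    rw [← hπc p (t j), ← h1, hsec]
  have hst := eq_of_heq (Sigma.mk.inj hst).2
  have hsv : s v = Sum.inr p.2 := by
    have := congrFun hst k
    simpa using this
  have hsl : s (e.2 l) = unfoldCopy F v X p (e.2 l) := by
    have := congrFun hst l
    rwa [Function.update_of_ne hkl.symm] at this
  have hpv : s v ≠ unfoldCopy F v X p v := by
    rw [hsv]
    simp only [unfoldCopy, if_true]
    exact fun hh => hp (Sum.inr.inj hh).symm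
  have key : ∀ u, F.ConnAvoiding e (e.2 l) u → s u = unfoldCopy F v X p u := by
    intro u hu
    induction hu with
    | refl => exact hsl
    | tail _ hab ih =>
      obtain ⟨e', hne, he', ⟨a, rfl⟩, ⟨b, rfl⟩⟩ := hab
      obtain ⟨q, hq⟩ := hedge e' he' hne
      have hav : e'.2 a ≠ v := fun hav => hpv (hav ▸ ih)
      have hqp : q = p := by
        have := (hq a).symm.trans ih
        simp only [unfoldCopy, if_neg hav] at this
        exact (Prod.mk.inj (Sum.inl.inj this)).2
      rw [hq b, hqp]
  exact hpv (key v hconn.symm)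

/-- `S` is a union of branches of `A` at `v`: no edge joins `S` to a vertex outside
`S ∪ {v}`. -/
def IsLobe (A : RelStruct I δ) (v : A.carrier) (S : Set A.carrier) : Prop :=
  v ∉ S ∧ ∀ e, A.IsEdge e → ∀ j, e.2 j ∈ S → ∀ k, e.2 k ∈ insert v S

/-- The branches in `S` can be mapped to `D` with the root `v` going to `d`. -/
def Extends (A D : RelStruct I δ) (v : A.carrier) (S : Set A.carrier) (d : D.carrier) : Prop :=
  ∃ g : A.carrier → D.carrier, g v = d ∧
    ∀ e, A.IsEdge e → ∀ j, e.2 j ∈ S → g ∘ e.2 ∈ D.rel e.1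

/-- `S` is a smallest lobe at `v` that does not extend `v ↦ d`. -/
structure IsMinBad (A D : RelStruct I δ) (v : A.carrier) (d : D.carrier) (S : Set A.carrier) :
    Prop where
  lobe : A.IsLobe v S
  bad : ¬ A.Extends D v S d
  le : ∀ T, A.IsLobe v T → ¬ A.Extends D v T d → S.ncard ≤ T.ncard

section Lobes

variable {A D : RelStruct I δ} {v : A.carrier} {d : D.carrier} {S T : Set A.carrier}

lemma IsLobe.inter (hS : A.IsLobe v S) (hT : A.IsLobe v T) : A.IsLobe v (S ∩ T) := by
  refine ⟨fun h => hS.1 h.1, fun e he j hj k => ?_⟩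
  rcases hS.2 e he j hj.1 k with h | h
  · exact Or.inl h
  rcases hT.2 e he j hj.2 k with h' | h'
  · exact Or.inl h'
  exact Or.inr ⟨h, h'⟩

lemma IsLobe.diff (hS : A.IsLobe v S) (hT : A.IsLobe v T) : A.IsLobe v (S \ T) := by
  refine ⟨fun h => hS.1 h.1, fun e he j hj k => ?_⟩
  rcases hS.2 e he j hj.1 k with h | h
  · exact Or.inl h
  refine Or.inr ⟨h, fun hk => ?_⟩
  rcases hT.2 e he k hk j with h' | h'
  · exact hS.1 (h' ▸ hj.1)
  · exact hj.2 h'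

lemma Extends.of_inter_of_diff (hS : A.IsLobe v S) (hT : A.IsLobe v T)
    (h1 : A.Extends D v (S ∩ T) d) (h2 : A.Extends D v (S \ T) d) : A.Extends D v S d := by
  classical
  obtain ⟨g, hg, hg'⟩ := h1
  obtain ⟨f, hf, hf'⟩ := h2
  refine ⟨fun u => if u ∈ T then g u else f u, by simp [hT.1, hf], fun e he j hj => ?_⟩
  by_cases hjT : e.2 j ∈ T
  · convert hg' e he j ⟨hj, hjT⟩ using 1
    funext k
    rcases hT.2 e he j hjT k with h | h
    · simp [h, hT.1, hf, hg]
    · simp [h]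
  · convert hf' e he j ⟨hj, hjT⟩ using 1
    funext k
    rcases (hS.diff hT).2 e he j ⟨hj, hjT⟩ k with h | h
    · simp [h, hT.1]
    · simp [h.2]

lemma IsMinBad.nonempty (h : A.IsMinBad D v d S) : S.Nonempty := by
  by_contra hS
  rw [Set.not_nonempty_iff_eq_empty] at hS
  subst hS
  exact h.bad ⟨fun _ => d, rfl, fun e _ j hj => hj.elim⟩

lemma IsMinBad.subset (h : A.IsMinBad D v d S) (hT : A.IsLobe v T) {w : A.carrier}
    (hwS : w ∈ S) (hwT : w ∈ T) : S ⊆ T := by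
  by_contra hST
  obtain ⟨x, hxS, hxT⟩ := Set.not_subset.1 hST
  have h1 : A.Extends D v (S ∩ T) d := by
    by_contra hb
    refine absurd (h.le _ (h.lobe.inter hT) hb) (not_le.2 (Set.ncard_lt_ncard ?_))
    exact ⟨Set.inter_subset_left, fun hh => hxT (hh hxS).2⟩
  have h2 : A.Extends D v (S \ T) d := by
    by_contra hb
    refine absurd (h.le _ (h.lobe.diff hT) hb) (not_le.2 (Set.ncard_lt_ncard ?_))
    exact ⟨Set.sdiff_subset, fun hh => (hh hwS).2 hwT⟩
  exact h.bad (Extends.of_inter_of_diff h.lobe hT h1 h2)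

lemma IsMinBad.eq_of_mem {d' : D.carrier} (h : A.IsMinBad D v d S) (h' : A.IsMinBad D v d' T)
    {w : A.carrier} (hwS : w ∈ S) (hwT : w ∈ T) : S = T :=
  (h.subset h'.lobe hwS hwT).antisymm (h'.subset h.lobe hwT hwS)

end Lobes

lemma Acyclic.eq_of_apply_eq {A : RelStruct I δ} (hA : A.Acyclic) {e : A.Tuple} (he : A.IsEdge e)
    {k l : Fin (δ e.1)} (h : e.2 k = e.2 l) : k = l := by
  by_contra hne
  apply hA e he k l hne
  rw [h]
  exact Relation.ReflTransGen.refl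

lemma exists_fin_ne (hδ : ∀ i, 2 ≤ δ i) (i : I) (j : Fin (δ i)) : ∃ k, k ≠ j :=
  haveI := Fin.nontrivial_iff_two_le.2 (hδ i)
  exists_ne j

lemma exists_isMinBad (hδ : ∀ i, 2 ≤ δ i) {F D : RelStruct I δ} (hF : F.Acyclic)
    (hFD : ¬ HomTo F D) (v : F.carrier) (d : D.carrier) : ∃ S, F.IsMinBad D v d S := by
  have hne : {S | F.IsLobe v S ∧ ¬ F.Extends D v S d}.Nonempty := by
    refine ⟨{v}ᶜ, ⟨by simp, fun e _ j _ k => by by_cases h : e.2 k = v <;> simp [h]⟩, ?_⟩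
    rintro ⟨g, -, hg⟩
    refine hFD ⟨g, fun i t ht => ?_⟩
    have j : Fin (δ i) := ⟨0, by have := hδ i; omega⟩
    by_cases hj : t j = v
    · obtain ⟨k, hk⟩ := exists_fin_ne hδ i j
      refine hg ⟨i, t⟩ ht k fun hkv => hk ?_
      exact hF.eq_of_apply_eq (e := ⟨i, t⟩) ht (Eq.trans hkv hj.symm)
    · exact hg ⟨i, t⟩ ht j hj
  obtain ⟨S, hS, hmin⟩ := (measure Set.ncard).wf.has_min _ hne
  exact ⟨S, hS.1, hS.2, fun T hT hT' => not_lt.1 (hmin T ⟨hT, hT'⟩)⟩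

/-- Gluing along an edge: if all lobes smaller than `S` at the positions of `e` extend,
then so does `S`. -/
lemma extends_of_edge (hδ : ∀ i, 2 ≤ δ i) {F D : RelStruct I δ} (hF : F.Acyclic)
    {v : F.carrier} {S : Set F.carrier} (hS : F.IsLobe v S) {e : F.Tuple} (he : F.IsEdge e)
    {j : Fin (δ e.1)} (hj : e.2 j = v) {l : Fin (δ e.1)} (hl : e.2 l ∈ S)
    {c : Fin (δ e.1) → D.carrier} (hc : c ∈ D.rel e.1)
    (hsmall : ∀ k T, F.IsLobe (e.2 k) T → T.ncard < S.ncard → F.Extends D (e.2 k) T (c k)) :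
    F.Extends D v S (c j) := by
  classical
  have hmem : ∀ k, k ≠ j → e.2 k ∈ S := by
    intro k hk
    rcases hS.2 e he l hl k with h | h
    · exact absurd (hF.eq_of_apply_eq he (h.trans hj.symm)) hk
    · exact h
  have hsep : ∀ k k', F.ConnAvoiding e (e.2 k) (e.2 k') → k = k' := fun k k' h => by
    by_contra hne
    exact hF e he k k' hne h
  have hne_of : ∀ e' k a, e'.2 a ≠ e.2 k → F.ConnAvoiding e (e.2 k) (e'.2 a) → e' ≠ e := by
    rintro e' k a h1 h2 rfl
    exact h1 (congrArg _ (hsep _ _ h2).symm)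
  have hbranch : ∀ k, ∃ g : F.carrier → D.carrier, g (e.2 k) = c k ∧
      ∀ e', F.IsEdge e' → ∀ a, e'.2 a ∈ {u ∈ S | F.ConnAvoiding e (e.2 k) u ∧ u ≠ e.2 k} →
        g ∘ e'.2 ∈ D.rel e'.1 := by
    intro k
    refine hsmall k _ ⟨fun h => h.2.2 rfl, ?_⟩ (Set.ncard_lt_ncard ⟨fun u hu => hu.1, ?_⟩)
    · rintro e' he' a ⟨haS, hac, hak⟩ b
      have hconn := hac.trans (he'.connAvoiding (hne_of e' k a hak hac) a b)
      by_cases hbk : e'.2 b = e.2 k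
      · exact Or.inl hbk
      refine Or.inr ⟨?_, hconn, hbk⟩
      rcases hS.2 e' he' a haS b with h | h
      · rw [h, ← hj] at hconn hbk
        exact absurd (congrArg e.2 (hsep _ _ hconn).symm) hbk
      · exact h
    · intro hsub
      by_cases hkj : k = j
      · obtain ⟨m, hm⟩ := exists_fin_ne hδ e.1 j
        exact hm ((hsep _ _ (hsub (hmem m hm)).2.1).symm.trans hkj)
      · exact (hsub (hmem k hkj)).2.2 rfl
  have hrest : ∃ g : F.carrier → D.carrier, g (e.2 j) = c j ∧
      ∀ e', F.IsEdge e' → ∀ a, e'.2 a ∈ {u ∈ S | ∀ k, ¬ F.ConnAvoiding e (e.2 k) u} →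
        g ∘ e'.2 ∈ D.rel e'.1 := by
    refine hsmall j _ ⟨fun h => hS.1 (hj ▸ h.1), ?_⟩ (Set.ncard_lt_ncard ⟨fun u hu => hu.1, ?_⟩)
    · rintro e' he' a ⟨haS, hac⟩ b
      rcases hS.2 e' he' a haS b with h | h
      · exact Or.inl (h.trans hj.symm)
      · refine Or.inr ⟨h, fun k hk => ?_⟩
        have hne : e' ≠ e := by
          rintro rfl
          exact hac a Relation.ReflTransGen.refl
        exact hac k (hk.trans (he'.connAvoiding hne b a))
    · exact fun hsub => (hsub hl).2 l Relation.ReflTransGen.refl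
  choose g hgc hg using hbranch
  obtain ⟨r, -, hr⟩ := hrest
  let G : F.carrier → D.carrier := fun u =>
    if hu : ∃ k, F.ConnAvoiding e (e.2 k) u then g hu.choose u else r u
  have hG : ∀ k u, F.ConnAvoiding e (e.2 k) u → G u = g k u := by
    intro k u hu
    have hex : ∃ k, F.ConnAvoiding e (e.2 k) u := ⟨k, hu⟩
    have : hex.choose = k := hsep _ _ (hex.choose_spec.trans hu.symm)
    simp only [G, dif_pos hex, this]
  have hGe : ∀ k, G (e.2 k) = c k := fun k => by
    rw [hG k _ Relation.ReflTransGen.refl, hgc]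
  refine ⟨G, hj ▸ hGe j, fun e' he' a ha => ?_⟩
  by_cases hee : e' = e
  · subst hee
    convert hc using 1
    exact funext hGe
  by_cases hak : ∃ k, F.ConnAvoiding e (e.2 k) (e'.2 a)
  · obtain ⟨k, hk⟩ := hak
    have hin : ∀ b, F.ConnAvoiding e (e.2 k) (e'.2 b) := fun b =>
      hk.trans (he'.connAvoiding hee a b)
    have hcomp : G ∘ e'.2 = g k ∘ e'.2 := funext fun b => hG k _ (hin b)
    rw [hcomp]
    by_cases hak' : e'.2 a = e.2 k
    · obtain ⟨b, hb⟩ := exists_fin_ne hδ e'.1 a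
      have hbk : e'.2 b ≠ e.2 k := fun h => hb (hF.eq_of_apply_eq he' (h.trans hak'.symm))
      refine hg k e' he' b ⟨?_, hin b, hbk⟩
      rcases hS.2 e' he' a ha b with h | h
      · have hkj := hsep k j (by rw [hj, ← h]; exact hin b)
        exact absurd (by rw [h, hkj, hj]) hbk
      · exact h
    · exact hg k e' he' a ⟨ha, hk, hak'⟩
  · have hcomp : G ∘ e'.2 = r ∘ e'.2 := by
      funext b
      have hb : ¬ ∃ k, F.ConnAvoiding e (e.2 k) (e'.2 b) := fun ⟨k, hk⟩ =>
        hak ⟨k, hk.trans (he'.connAvoiding hee b a)⟩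
      simp only [Function.comp, G, dif_neg hb]
    rw [hcomp]
    exact hr e' he' a ⟨ha, not_exists.1 hak⟩

/-- The image of `D` under a map of vertices. -/
def image (D : RelStruct I δ) {Y : Type} (φ : D.carrier → Y) : RelStruct I δ where
  carrier := Set.range φ
  finite := inferInstance
  nonempty := inferInstance
  rel i := {s | ∃ c ∈ D.rel i, s = Set.rangeFactorization φ ∘ c}

lemma isHom_image (D : RelStruct I δ) {Y : Type} (φ : D.carrier → Y) :
    IsHom D (D.image φ) (Set.rangeFactorization φ) :=
  fun _ c hc => ⟨c, hc, rfl⟩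

/-- A lobe not joined to its root extends whenever proper substructures do. -/
lemma DualityPair.extends_of_closed {F D : RelStruct I δ} (h : DualityPair F D)
    (hF : ∀ f, IsHom F F f → Function.Surjective f) {v : F.carrier} {S : Set F.carrier}
    (hS : F.IsLobe v S) (hne : S.Nonempty)
    (hclosed : ∀ e, F.IsEdge e → ∀ j, e.2 j ∈ S → ∀ k, e.2 k ≠ v) (d : D.carrier) :
    F.Extends D v S d := by
  classical
  have hFS : ¬ HomTo F (F.Substruct S hne) := by
    rintro ⟨f, hf⟩
    obtain ⟨u, hu⟩ := hF (fun u => (f u).1) (fun i e he => hf i e he) v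
    exact hS.1 (hu ▸ (f u).2)
  obtain ⟨g, hg⟩ : HomTo (F.Substruct S hne) D := not_not.1 fun hn => hFS ((h _).2 hn)
  refine ⟨fun u => if hu : u ∈ S then g ⟨u, hu⟩ else d, by simp [hS.1], fun e he j hj => ?_⟩
  have hin : ∀ k, e.2 k ∈ S := fun k =>
    (hS.2 e he j hj k).resolve_left (hclosed e he j hj k)
  have := hg e.1 (fun k => ⟨e.2 k, hin k⟩) he
  convert this using 1
  funext k
  simp only [Function.comp, dif_pos (hin k)]

end RelStruct

end ThesisFormal

open ThesisFormal RelStruct in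
/-- If `(F, D)` is a duality pair with `D` a core and `F` has
`n` vertices, then `D` has at most `n ^ n` vertices. -/
theorem stmt_10 {I : Type} [Finite I] {δ : I → ℕ} (hδ : ∀ i, 2 ≤ δ i)
    (F D : RelStruct I δ) (h : DualityPair F D) (hD : D.IsCore) :
    Nat.card D.carrier ≤ Nat.card F.carrier ^ Nat.card F.carrier := by
  obtain ⟨F', hF'D, hcard, hrigid⟩ := h.exists_rigid
  have := F'.finite
  have := F'.nonempty
  have hac := hF'D.acyclic hrigid
  choose S hS using exists_isMinBad hδ hac hF'D.not_homTo
  choose φ hφ using fun (d : D.carrier) (v : F'.carrier) => (hS v d).nonempty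
  have hSφ : ∀ d d', φ d = φ d' → ∀ v, S v d = S v d' := fun d d' hdd v =>
    (hS v d).eq_of_mem (hS v d') (hφ d v) (by rw [hdd]; exact hφ d' v)
  have hnot : ¬ HomTo F' (D.image φ) := by
    rintro ⟨f, hf⟩
    choose r hr using fun v => (f v).2
    obtain ⟨v, hv⟩ := Finite.exists_min fun v => (S v (r v)).ncard
    have hbad := (hS v (r v)).bad
    by_cases hclosed : ∀ e, F'.IsEdge e → ∀ j, e.2 j ∈ S v (r v) → ∀ k, e.2 k ≠ v
    · exact hbad (hF'D.extends_of_closed hrigid (hS v (r v)).lobe (hS v (r v)).nonempty hclosed _)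
    push Not at hclosed
    obtain ⟨e, he, l, hl, j, hj⟩ := hclosed
    obtain ⟨c, hc, hfc⟩ := hf e.1 e.2 he
    have hcr : ∀ k u, S u (c k) = S u (r (e.2 k)) := by
      intro k
      apply hSφ
      rw [hr]
      exact (congrArg Subtype.val (congrFun hfc k)).symm
    have hSj : S v (c j) = S v (r v) := by rw [hcr j v, hj]
    refine (hS v (c j)).bad ?_
    rw [hSj]
    refine extends_of_edge hδ hac (hS v (r v)).lobe he hj hl hc fun k T hT hlt => ?_
    by_contra hb
    have h1 := (hS (e.2 k) (c k)).le T hT hb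
    rw [hcr] at h1
    exact absurd (hv (e.2 k)) (not_le.2 (h1.trans_lt hlt))
  obtain ⟨ψ, hψ⟩ : HomTo (D.image φ) D := not_not.1 fun hn => hnot ((hF'D _).2 hn)
  have hinj := hD.injective (hψ.comp (isHom_image D φ))
  have hφinj : Function.Injective φ := fun a b hab =>
    hinj (congrArg ψ (Subtype.ext hab))
  calc Nat.card D.carrier ≤ Nat.card (F'.carrier → F'.carrier) :=
        Nat.card_le_card_of_injective φ hφinj
    _ = Nat.card F'.carrier ^ Nat.card F'.carrier := Nat.card_fun
    _ ≤ Nat.card F.carrier ^ Nat.card F'.carrier := Nat.pow_le_pow_left hcard _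
    _ ≤ Nat.card F.carrier ^ Nat.card F.carrier :=
        Nat.pow_le_pow_right (Nat.card_pos.trans_le hcard) hcard
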